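/- arXiv:1303.7273 — 3 statements merged into one kernel-verified Lean document; each statement's English description precedes it below -/
import Mathlib

section
/- Let k be a field and G a finite cyclic group of order l such that l is invertible in k. Let S and R be commutative k-algebras equipped with G-actions by k-algebra automorphisms, and let f : S → R be a G-equivariant k-algebra homomorphism. Let A be an Artinian k-algebra with a G-action by k-algebra automorphisms, let I ⊆ A be a G-invariant ideal with I² = 0, and let π : A → A/I be the quotient map. Suppose given a G-equivariant k-algebra homomorphism q : S → A and a G-equivariant k-algebra homomorphism p : R → A/I with π ∘ q = p ∘ f. If there exists a k-algebra homomorphism h : R → A with h ∘ f = q and π ∘ h = p, then there exists a G-equivariant k-algebra homomorphism h̃ : R → A with h̃ ∘ f = q and π ∘ h̃ = p. -/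
theorem smul_sum_const_of_mul_card_eq_one {k M ι : Type*} [CommRing k] [AddCommGroup M]
    [Module k M] [Fintype ι] {c : k} (hc : c * Fintype.card ι = 1) (m : M) : c • ∑ _i : ι, m = m := by
  rw [Finset.sum_const, Finset.card_univ, ← Nat.cast_smul_eq_nsmul k, smul_smul, hc, one_smul]

namespace AlgHom

variable {k R A ι : Type*} [CommRing k] [CommRing R] [CommRing A] [Algebra k R] [Algebra k A]
  [Fintype ι]

/-- The average of finitely many algebra homomorphisms which all agree with `h` modulo a
square-zero ideal is again an algebra homomorphism. -/
def average (F : ι → R →ₐ[k] A) (h : R →ₐ[k] A) {I : Ideal A} (hI : I ^ 2 = ⊥)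
    (hF : ∀ i x, F i x - h x ∈ I) (c : k) (hc : c * Fintype.card ι = 1) : R →ₐ[k] A :=
  have hconst := smul_sum_const_of_mul_card_eq_one (M := A) hc
  have hmul_zero {a b : A} (ha : a ∈ I) (hb : b ∈ I) : a * b = 0 := by
    rw [← Ideal.mem_bot, ← hI, pow_two]
    exact Ideal.mul_mem_mul ha hb
  have hsub (x : R) : c • ∑ i, F i x - h x ∈ I := by
    rw [← hconst (h x), ← smul_sub, ← Finset.sum_sub_distrib]
    exact I.smul_of_tower_mem c (I.sum_mem fun i _ => hF i x)
  AlgHom.ofLinearMap (c • ∑ i, (F i).toLinearMap)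
    (by simpa [LinearMap.sum_apply] using hconst 1)
    (by
      intro x y
      simp only [LinearMap.smul_apply, LinearMap.sum_apply, AlgHom.toLinearMap_apply]
      have hterm (i : ι) : F i (x * y) = h x * F i y + h y * F i x - h x * h y := by
        rw [map_mul]
        linear_combination hmul_zero (hF i x) (hF i y)
      have hsum : c • ∑ i, F i (x * y) =
          h x * (c • ∑ i, F i y) + h y * (c • ∑ i, F i x) - h x * h y := by
        simp_rw [hterm]
        rw [Finset.sum_sub_distrib, smul_sub, hconst, Finset.sum_add_distrib, ← Finset.mul_sum,
          ← Finset.mul_sum, smul_add, mul_smul_comm, mul_smul_comm]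
      linear_combination hsum - hmul_zero (hsub x) (hsub y))

theorem average_apply (F : ι → R →ₐ[k] A) (h : R →ₐ[k] A) {I : Ideal A} (hI : I ^ 2 = ⊥)
    (hF : ∀ i x, F i x - h x ∈ I) (c : k) (hc : c * Fintype.card ι = 1) (x : R) :
    average F h hI hF c hc x = c • ∑ i, F i x := by
  simp [average, LinearMap.sum_apply]

/-- If the linear map `l` takes the value `m` at every `F i x`, then it takes the value `m` at the
average of the `F i x`. -/
theorem map_average_eq {M : Type*} [AddCommGroup M] [Module k M] (l : A →ₗ[k] M)
    (F : ι → R →ₐ[k] A) (h : R →ₐ[k] A) {I : Ideal A} (hI : I ^ 2 = ⊥)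
    (hF : ∀ i x, F i x - h x ∈ I) (c : k) (hc : c * Fintype.card ι = 1) {x : R} {m : M}
    (hx : ∀ i, l (F i x) = m) : l (average F h hI hF c hc x) = m := by
  rw [average_apply, map_smul, map_sum, Finset.sum_congr rfl fun i _ => hx i,
    smul_sum_const_of_mul_card_eq_one hc]

end AlgHom

/-- **Equivariant infinitesimal lifting** (Lemma 2.1 of the paper).  Let `k` be a field
and `G` a finite cyclic group whose order is invertible in `k`, acting on commutative
`k`-algebras `S`, `R`, `A` by `k`-algebra automorphisms.  Let `f : S → R` be a
`G`-equivariant `k`-algebra homomorphism, `I ⊆ A` a `G`-invariant ideal with `I² = 0`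
in an Artinian `k`-algebra `A`, and endow `A ⧸ I` with the induced `G`-action (given
here as an action compatible with the quotient map).  Given a `G`-equivariant square of
`k`-algebra homomorphisms `q : S → A`, `p : R → A ⧸ I` with `π ∘ q = p ∘ f`, if `p`
admits a (not necessarily equivariant) lift `h : R → A` with `h ∘ f = q`, then `p`
admits a `G`-equivariant lift with the same properties. -/
theorem equivariant_infinitesimal_lifting
    (k : Type) [Field k] (G : Type) [Group G] [Fintype G] [IsCyclic G]
    (hG : IsUnit ((Fintype.card G : k)))
    (S R A : Type) [CommRing S] [CommRing R] [CommRing A]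
    [Algebra k S] [Algebra k R] [Algebra k A]
    [MulSemiringAction G S] [SMulCommClass G k S]
    [MulSemiringAction G R] [SMulCommClass G k R]
    [MulSemiringAction G A] [SMulCommClass G k A]
    [IsArtinianRing A]
    (f : S →ₐ[k] R) (hf : ∀ (g : G) (s : S), f (g • s) = g • f s)
    (I : Ideal A) (hI2 : I ^ 2 = ⊥) (hIinv : ∀ (g : G), ∀ a ∈ I, g • a ∈ I)
    [MulSemiringAction G (A ⧸ I)] [SMulCommClass G k (A ⧸ I)]
    (hquot : ∀ (g : G) (a : A),
      g • (Ideal.Quotient.mk I a) = Ideal.Quotient.mk I (g • a))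
    (q : S →ₐ[k] A) (hq : ∀ (g : G) (s : S), q (g • s) = g • q s)
    (p : R →ₐ[k] (A ⧸ I)) (hp : ∀ (g : G) (r : R), p (g • r) = g • p r)
    (hsquare : (Ideal.Quotient.mkₐ k I).comp q = p.comp f)
    (hlift : ∃ h : R →ₐ[k] A, h.comp f = q ∧ (Ideal.Quotient.mkₐ k I).comp h = p) :
    ∃ htil : R →ₐ[k] A, (∀ (g : G) (r : R), htil (g • r) = g • htil r) ∧
      htil.comp f = q ∧ (Ideal.Quotient.mkₐ k I).comp htil = p := by
  obtain ⟨h, hhf, hhp⟩ := hlift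
  obtain ⟨c, hc⟩ := hG.exists_left_inv
  have hhf' (s : S) : h (f s) = q s := DFunLike.congr_fun hhf s
  have hhp' (r : R) : Ideal.Quotient.mk I (h r) = p r := DFunLike.congr_fun hhp r
  let F (g : G) : R →ₐ[k] A := (MulSemiringAction.toAlgHom k A g).comp
    (h.comp (MulSemiringAction.toAlgHom k R g⁻¹))
  have hF (g : G) (r : R) : F g r = g • h (g⁻¹ • r) := rfl
  have hFp (g : G) (r : R) : Ideal.Quotient.mk I (F g r) = p r := by
    rw [hF, ← hquot, hhp', ← hp, smul_inv_smul]
  have hFI (g : G) (r : R) : F g r - h r ∈ I := by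
    rw [← Ideal.Quotient.eq, hFp, hhp']
  refine ⟨AlgHom.average F h hI2 hFI c hc, fun g r => ?_, AlgHom.ext fun s => ?_,
    AlgHom.ext fun r => ?_⟩
  · rw [AlgHom.average_apply, AlgHom.average_apply, smul_comm g c, Finset.smul_sum (r := g),
      ← Equiv.sum_comp (Equiv.mulLeft g)]
    simp [hF, mul_smul]
  · refine AlgHom.map_average_eq LinearMap.id F h hI2 hFI c hc fun g => ?_
    change g • h (g⁻¹ • f s) = q s
    rw [← hf, hhf', ← hq, smul_inv_smul]
  · exact AlgHom.map_average_eq (Ideal.Quotient.mkₐ k I).toLinearMap F h hI2 hFI c hc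
      fun g => hFp g r
end

section
/- Let k be a field and G a finite cyclic group whose order is invertible in k. Let (S, m) be a Noetherian local k-algebra that is m-adically complete, equipped with a G-action by k-algebra automorphisms preserving m (so G acts on the residue field S/m). Let R be a commutative S-algebra with a G-action by k-algebra automorphisms making the structure map S → R equivariant, and assume R is formally smooth as an S-algebra. Let p : R → S/m be a G-equivariant S-algebra homomorphism. Then there exists a G-equivariant S-algebra homomorphism h : R → S such that the composition of h with the quotient map S → S/m equals p. (This is the algebraic content of the existence of a G-equivariant formal section through a fixed point at which an equivariant morphism is smooth.) -/
open IsLocalRing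

/-- Completeness with respect to an ideal passes to its positive powers. -/
theorem IsAdicComplete.pow {S : Type*} [CommRing S] (I : Ideal S) [IsAdicComplete I S]
    {k : ℕ} (hk : k ≠ 0) : IsAdicComplete (I ^ k) S where
  haus' x hx := by
    refine IsHausdorff.haus (I := I) inferInstance x fun n ↦ (hx n).mono ?_
    rw [← pow_mul]
    exact Submodule.smul_mono_left (Ideal.pow_le_pow_right (Nat.le_mul_of_pos_left n (by lia)))
  prec' f hf := by
    obtain ⟨L, hL⟩ := IsPrecomplete.prec (I := I) inferInstance (f := f)
      fun {m n} hmn ↦ (hf hmn).mono <| by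
        rw [← pow_mul]
        exact Submodule.smul_mono_left
          (Ideal.pow_le_pow_right (Nat.le_mul_of_pos_left m (by lia)))
    refine ⟨L, fun n ↦ (hf (Nat.le_mul_of_pos_left n (Nat.pos_of_ne_zero hk))).trans ?_⟩
    simpa only [← pow_mul] using hL (k * n)

/-- The average of finitely many algebra homomorphisms which agree modulo `J` is an algebra
homomorphism modulo `J ^ 2`. -/
theorem AlgHom.exists_eq_mk_average {R A B ι : Type*} [CommRing R] [CommRing A] [CommRing B]
    [Algebra R A] [Algebra R B] [Fintype ι] {e : B} (he : e * (Fintype.card ι : B) = 1)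
    (J : Ideal B) (h : A →ₐ[R] B) (f : ι → A →ₐ[R] B) (hf : ∀ i x, f i x - h x ∈ J) :
    ∃ F : A →ₐ[R] B ⧸ J ^ 2, ∀ x, F x = Ideal.Quotient.mk (J ^ 2) (e * ∑ i, f i x) := by
  have const (b : B) : e * ∑ _i : ι, b = b := by
    rw [Finset.sum_const, Finset.card_univ, nsmul_eq_mul, ← mul_assoc, he, one_mul]
  have mul (x y : A) : e * ∑ i, f i (x * y) - (e * ∑ i, f i x) * (e * ∑ i, f i y) ∈ J ^ 2 := by
    have split (x : A) : e * ∑ i, f i x = h x + e * ∑ i, (f i x - h x) := by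
      rw [Finset.sum_sub_distrib, mul_sub, const]; ring
    have expand : e * ∑ i, f i (x * y) = h x * h y + h x * (e * ∑ i, (f i y - h y))
        + h y * (e * ∑ i, (f i x - h x)) + e * ∑ i, (f i x - h x) * (f i y - h y) := by
      rw [← const (h x * h y)]
      simp only [Finset.mul_sum, ← Finset.sum_add_distrib]
      refine Finset.sum_congr rfl fun i _ ↦ ?_
      rw [map_mul]; ring
    rw [expand, split x, split y]
    have key : e * ∑ i, (f i x - h x) * (f i y - h y)
        - (e * ∑ i, (f i x - h x)) * (e * ∑ i, (f i y - h y)) ∈ J ^ 2 := by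
      rw [sq]
      refine sub_mem (Ideal.mul_mem_left _ _ (sum_mem fun i _ ↦ ?_)) (Ideal.mul_mem_mul ?_ ?_)
      · exact Ideal.mul_mem_mul (hf i x) (hf i y)
      · exact Ideal.mul_mem_left _ _ (sum_mem fun i _ ↦ hf i x)
      · exact Ideal.mul_mem_left _ _ (sum_mem fun i _ ↦ hf i y)
    convert key using 1
    ring
  let L : A →ₗ[R] B ⧸ J ^ 2 := (Ideal.Quotient.mkₐ R (J ^ 2)).toLinearMap ∘ₗ
    LinearMap.mulLeft R e ∘ₗ ∑ i, (f i).toLinearMap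
  have hL (x : A) : L x = Ideal.Quotient.mk (J ^ 2) (e * ∑ i, f i x) := by
    simp [L, Finset.mul_sum]
  refine ⟨AlgHom.ofLinearMap L ?_ fun x y ↦ ?_, hL⟩
  · rw [hL]
    simp only [map_one, const]
  · rw [hL, hL, hL, ← map_mul]
    exact Ideal.Quotient.eq.mpr (mul x y)

section Equivariant

variable {G S R : Type*} [Group G] [CommRing S] [CommRing R] [Algebra S R]
  [MulSemiringAction G S] [MulSemiringAction G R]

theorem Ideal.smul_mem_pow {I : Ideal S} (hI : ∀ (g : G), ∀ s ∈ I, g • s ∈ I) (n : ℕ)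
    (g : G) {s : S} (hs : s ∈ I ^ n) : g • s ∈ I ^ n := by
  have hle : I.map (MulSemiringAction.toRingHom G S g) ≤ I := Ideal.map_le_iff_le_comap.mpr (hI g)
  have := Ideal.mem_map_of_mem (MulSemiringAction.toRingHom G S g) hs
  rw [Ideal.map_pow] at this
  exact Ideal.pow_right_mono hle n this

/-- The conjugate `r ↦ g • h (g⁻¹ • r)` of an algebra homomorphism by a group element. -/
def AlgHom.conjSMul
    (hstruct : ∀ (g : G) (s : S), g • (algebraMap S R s) = algebraMap S R (g • s))
    (h : R →ₐ[S] S) (g : G) : R →ₐ[S] S where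
  __ := ((MulSemiringAction.toRingHom G S g).comp (h : R →+* S)).comp
    (MulSemiringAction.toRingHom G R g⁻¹)
  commutes' s := by
    change g • h (g⁻¹ • algebraMap S R s) = s
    rw [hstruct, h.commutes]
    exact smul_inv_smul g s

variable [Fintype G]

/-- A homomorphism equivariant modulo `J` can be corrected modulo `J` so that it becomes
equivariant modulo `J ^ 2`. -/
theorem Algebra.FormallySmooth.exists_equivariant_mod_sq [Algebra.FormallySmooth S R]
    (hG : IsUnit (Fintype.card G : S))
    (hstruct : ∀ (g : G) (s : S), g • (algebraMap S R s) = algebraMap S R (g • s))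
    (J : Ideal S) (hJ : ∀ (g : G), ∀ s ∈ J, g • s ∈ J) [IsAdicComplete (J ^ 2) S]
    (h : R →ₐ[S] S) (hh : ∀ (g : G) r, h (g • r) - g • h r ∈ J) :
    ∃ h' : R →ₐ[S] S, (∀ (g : G) r, h' (g • r) - g • h' r ∈ J ^ 2) ∧ ∀ r, h' r - h r ∈ J := by
  obtain ⟨e, he⟩ := hG.exists_left_inv
  have hge (g : G) : g • e = e := by
    have h1 : g • e * (Fintype.card G : S) = 1 := by
      have := congrArg (MulSemiringAction.toRingHom G S g) he
      rwa [map_mul, map_natCast, map_one] at this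
    exact hG.mul_right_cancel (h1.trans he.symm)
  have hconj (g : G) (r : R) : h.conjSMul hstruct g r - h r ∈ J := by
    have := J.neg_mem (hh g (g⁻¹ • r))
    rwa [smul_inv_smul, neg_sub] at this
  obtain ⟨F, hF⟩ := AlgHom.exists_eq_mk_average he J h (h.conjSMul hstruct) hconj
  obtain ⟨h', hh'⟩ := Algebra.FormallySmooth.exists_mkₐ_comp_eq_of_isAdicComplete F
  have hav (r : R) : h' r - e * ∑ g, h.conjSMul hstruct g r ∈ J ^ 2 :=
    Ideal.Quotient.eq.mp ((DFunLike.congr_fun hh' r).trans (hF r))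
  have hequiv (g : G) (r : R) : g • (e * ∑ c, h.conjSMul hstruct c r) =
      e * ∑ c, h.conjSMul hstruct c (g • r) := by
    rw [smul_mul', hge, Finset.smul_sum]
    congr 1
    refine Fintype.sum_equiv (Equiv.mulLeft g) _ _ fun c ↦ ?_
    change g • c • h (c⁻¹ • r) = (g * c) • h ((g * c)⁻¹ • g • r)
    rw [mul_smul, smul_smul _ g r, mul_inv_rev, inv_mul_cancel_right]
  refine ⟨h', fun g r ↦ ?_, fun r ↦ ?_⟩
  · have := sub_mem (hav (g • r)) (Ideal.smul_mem_pow hJ 2 g (hav r))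
    rwa [smul_sub, hequiv, sub_sub_sub_cancel_right] at this
  · have h1 : e * ∑ g, (h.conjSMul hstruct g r - h r) ∈ J :=
      Ideal.mul_mem_left _ _ (sum_mem fun g _ ↦ hconj g r)
    rw [Finset.sum_sub_distrib, mul_sub, Finset.sum_const, Finset.card_univ, nsmul_eq_mul,
      ← mul_assoc, he, one_mul] at h1
    simpa using add_mem (Ideal.pow_le_self two_ne_zero (hav r)) h1

/-- A homomorphism to an `I`-adically complete ring which is equivariant modulo `I` is congruent
modulo `I` to an equivariant one. -/
theorem Algebra.FormallySmooth.exists_equivariant [Algebra.FormallySmooth S R]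
    (hG : IsUnit (Fintype.card G : S))
    (hstruct : ∀ (g : G) (s : S), g • (algebraMap S R s) = algebraMap S R (g • s))
    (I : Ideal S) (hI : ∀ (g : G), ∀ s ∈ I, g • s ∈ I) [IsAdicComplete I S]
    (h₀ : R →ₐ[S] S) (hh₀ : ∀ (g : G) r, h₀ (g • r) - g • h₀ r ∈ I) :
    ∃ h : R →ₐ[S] S, (∀ (g : G) r, h (g • r) = g • h r) ∧ ∀ r, h r - h₀ r ∈ I := by
  have step (n : ℕ) (h : R →ₐ[S] S) (hh : ∀ (g : G) r, h (g • r) - g • h r ∈ I ^ (n + 1)) :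
      ∃ h' : R →ₐ[S] S, (∀ (g : G) r, h' (g • r) - g • h' r ∈ I ^ (n + 1 + 1)) ∧
        ∀ r, h' r - h r ∈ I ^ (n + 1) := by
    have : IsAdicComplete ((I ^ (n + 1)) ^ 2) S := by
      rw [← pow_mul]
      exact IsAdicComplete.pow I (by lia)
    obtain ⟨h', h1, h2⟩ := exists_equivariant_mod_sq hG hstruct (I ^ (n + 1))
      (fun g _ hs ↦ Ideal.smul_mem_pow hI _ g hs) h hh
    refine ⟨h', fun g r ↦ ?_, h2⟩
    have := h1 g r
    rw [← pow_mul] at this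
    exact Ideal.pow_le_pow_right (by lia) this
  choose! next next_equiv next_sub using step
  let u : ℕ → R →ₐ[S] S := fun n ↦ Nat.rec h₀ next n
  have u_equiv (n : ℕ) : ∀ (g : G) r, u n (g • r) - g • u n r ∈ I ^ (n + 1) := by
    induction n with
    | zero => rwa [zero_add, pow_one]
    | succ n ih => exact next_equiv n (u n) ih
  have u_sub {m n : ℕ} (hmn : m ≤ n) (r : R) : u n r - u m r ∈ I ^ (m + 1) := by
    induction n, hmn using Nat.le_induction with
    | base => simp
    | succ n hmn ih =>
      have := add_mem (Ideal.pow_le_pow_right (by lia) (next_sub n (u n) (u_equiv n) r)) ih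
      rwa [sub_add_sub_cancel] at this
  let h : R →ₐ[S] S := IsAdicComplete.liftAlgHom I
    (fun n ↦ (Ideal.Quotient.mkₐ S (I ^ n)).comp (u n)) fun {m n} hmn ↦ by
      ext r
      exact Ideal.Quotient.eq.mpr (Ideal.pow_le_pow_right m.le_succ (u_sub hmn r))
  have h_sub (n : ℕ) (r : R) : h r - u n r ∈ I ^ n :=
    Ideal.Quotient.eq.mp (IsAdicComplete.mk_liftAlgHom I _ _ n r)
  refine ⟨h, fun g r ↦ ?_, fun r ↦ ?_⟩
  · refine (IsHausdorff.eq_iff_smodEq (I := I)).mpr fun n ↦ ?_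
    rw [SModEq.sub_mem, smul_eq_mul, Ideal.mul_top]
    have := add_mem (sub_mem (h_sub n (g • r)) (Ideal.smul_mem_pow hI n g (h_sub n r)))
      (Ideal.pow_le_pow_right n.le_succ (u_equiv n g r))
    convert this using 1
    rw [smul_sub]; ring
  · have := add_mem (h_sub 1 r) (u_sub zero_le_one r)
    rwa [sub_add_sub_cancel, pow_one] at this

end Equivariant

/-- **Existence of G-equivariant formal sections** (algebraic form of Corollary 2.2 of
the paper).  Let `k` be a field and `G` a finite cyclic group of order invertible in
`k`.  Let `(S, m)` be a complete Noetherian local `k`-algebra with a `G`-action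
preserving `m` (inducing an action on the residue field `S/m`, given here as a
compatible action), and let `R` be a formally smooth `S`-algebra with a compatible
`G`-action.  Then every `G`-equivariant `S`-algebra homomorphism `p : R → S/m` lifts
to a `G`-equivariant `S`-algebra homomorphism `h : R → S`. -/
theorem equivariant_formal_section_of_formally_smooth
    (k : Type) [Field k] (G : Type) [Group G] [Fintype G] [IsCyclic G]
    (hG : IsUnit ((Fintype.card G : k)))
    (S : Type) [CommRing S] [IsNoetherianRing S] [IsLocalRing S] [Algebra k S]
    [IsAdicComplete (maximalIdeal S) S]
    [MulSemiringAction G S] [SMulCommClass G k S]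
    (hm : ∀ (g : G), ∀ s ∈ maximalIdeal S, g • s ∈ maximalIdeal S)
    (R : Type) [CommRing R] [Algebra k R] [Algebra S R] [IsScalarTower k S R]
    [MulSemiringAction G R] [SMulCommClass G k R]
    (hstruct : ∀ (g : G) (s : S), g • (algebraMap S R s) = algebraMap S R (g • s))
    [Algebra.FormallySmooth S R]
    [MulSemiringAction G (ResidueField S)] [SMulCommClass G k (ResidueField S)]
    (hres : ∀ (g : G) (s : S), g • (residue S s) = residue S (g • s))
    (p : R →ₐ[S] ResidueField S) (hp : ∀ (g : G) (r : R), p (g • r) = g • p r) :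
    ∃ h : R →ₐ[S] S, (∀ (g : G) (r : R), h (g • r) = g • h r) ∧
      ∀ r : R, residue S (h r) = p r := by
  have hGS : IsUnit (Fintype.card G : S) := by simpa using hG.map (algebraMap k S)
  obtain ⟨h₀, hh₀⟩ :=
    Algebra.FormallySmooth.exists_mkₐ_comp_eq_of_isAdicComplete (I := maximalIdeal S) p
  have hp₀ (r : R) : residue S (h₀ r) = p r := DFunLike.congr_fun hh₀ r
  obtain ⟨h, hequiv, hsub⟩ := Algebra.FormallySmooth.exists_equivariant hGS hstruct
    (maximalIdeal S) hm h₀ fun g r ↦ Ideal.Quotient.eq.mp <| by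
      change residue S _ = residue S _
      rw [hp₀, hp, ← hres, hp₀]
  exact ⟨h, hequiv, fun r ↦ (Ideal.Quotient.eq.mpr (hsub r)).trans (hp₀ r)⟩
end

section
/- Let K be a field of characteristic ≠ 2, let d ∈ K be a non-square, and let L = K(√d) be the corresponding quadratic extension with nontrivial K-automorphism σ (applied to vectors coordinatewise). Let n ≥ 1 and let f ∈ K[X₀,…,Xₙ] be a homogeneous polynomial of degree 3 with coefficients in K, and let x ∈ L^{n+1} satisfy f(x) = 0 (then also f(σ(x)) = 0, since the coefficients of f lie in K). Let a, b ∈ L be the unique elements such that the identity f(s·x + t·σ(x)) = s·t·(a·s + b·t) holds in the polynomial ring L[s,t], and suppose z := b·x − a·σ(x) ≠ 0. Then σ(a) = b, σ(z) = −z, and there exists a nonzero vector w ∈ K^{n+1} with z = √d·w and f(w) = 0. In particular, the cubic hypersurface {f = 0} has a K-rational point on the line spanned by the conjugate pair x, σ(x). -/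
/-- Evaluating a form of degree `m` at a scaled point multiplies its value by the `m`-th power of the
scalar. -/
theorem MvPolynomial.IsHomogeneous.aeval_mul_left {ι R A : Type*} [CommSemiring R] [CommSemiring A]
    [Algebra R A] {f : MvPolynomial ι R} {m : ℕ} (hf : f.IsHomogeneous m) (c : A) (v : ι → A) :
    MvPolynomial.aeval (fun i => c * v i) f = c ^ m * MvPolynomial.aeval v f := by
  simp only [MvPolynomial.aeval_def, MvPolynomial.eval₂_eq, Finset.mul_sum]
  refine Finset.sum_congr rfl fun e he => ?_
  have hdeg : ∑ i ∈ e.support, e i = m := by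
    simpa [Finsupp.degree, Finsupp.weight_apply, Finsupp.sum] using
      hf (MvPolynomial.mem_support_iff.mp he)
  simp only [mul_pow, Finset.prod_mul_distrib, Finset.prod_pow_eq_pow_sum, hdeg]
  ring

/-- **Descent of the third intersection point along a quadratic extension**
(used in the proof of the main theorem).  Let `K` be a field of characteristic `≠ 2`,
`d ∈ K` a non-square, and `L = K(√d)` the corresponding quadratic extension, with
`√d = sqd`, nontrivial `K`-automorphism `σ`, and every element of `L` of the form
`u + w·√d` with `u, w ∈ K`.  Let `f` be a homogeneous cubic form over `K`, let
`x ∈ L^{n+1}` be a zero of `f`, and let `a, b ∈ L` satisfy the identity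
`f(s·x + t·σ(x)) = s·t·(a·s + b·t)`.  If `z := b·x − a·σ(x)` is nonzero, then
`σ(a) = b`, `σ(z) = −z`, and `z = √d·w` for a nonzero `K`-rational zero `w` of `f`:
the cubic hypersurface `{f = 0}` has a `K`-point on the line spanned by the
conjugate pair `x, σ(x)`. -/
theorem cubic_K_point_from_conjugate_pair
    (K : Type) [Field K] (h2 : (2 : K) ≠ 0)
    (d : K) (hd : ¬ ∃ c : K, c ^ 2 = d)
    (L : Type) [Field L] [Algebra K L]
    (sqd : L) (hsqd : sqd ^ 2 = algebraMap K L d)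
    (σ : L ≃ₐ[K] L) (hσ : σ sqd = -sqd)
    (hspan : ∀ v : L, ∃ u w : K, v = algebraMap K L u + algebraMap K L w * sqd)
    (n : ℕ) (hn : 1 ≤ n)
    (f : MvPolynomial (Fin (n + 1)) K) (hf : f.IsHomogeneous 3)
    (x : Fin (n + 1) → L)
    (hx : MvPolynomial.eval x (MvPolynomial.map (algebraMap K L) f) = 0)
    (a b : L)
    (hab : ∀ s t : L,
      MvPolynomial.eval (fun i => s * x i + t * σ (x i))
        (MvPolynomial.map (algebraMap K L) f) = s * t * (a * s + b * t))
    (z : Fin (n + 1) → L) (hzdef : z = fun i => b * x i - a * σ (x i))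
    (hz : z ≠ 0) :
    σ a = b ∧ (∀ i, σ (z i) = - z i) ∧
      ∃ w : Fin (n + 1) → K, w ≠ 0 ∧
        (∀ i, z i = sqd * algebraMap K L (w i)) ∧
        MvPolynomial.eval w f = 0 := by
  simp only [MvPolynomial.eval_map, ← MvPolynomial.aeval_def] at hab
  have h2L : (2 : L) ≠ 0 := by
    rw [← map_ofNat (algebraMap K L) 2]
    exact (map_ne_zero (algebraMap K L)).mpr h2
  have hsqd0 : sqd ≠ 0 := by
    rintro rfl
    refine hd ⟨0, (algebraMap K L).injective ?_⟩
    simpa using hsqd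
  have hσσ : ∀ v, σ (σ v) = v := by
    intro v
    obtain ⟨u, w, rfl⟩ := hspan v
    simp [hσ]
  have hconj : ∀ v : Fin (n + 1) → L,
      σ (MvPolynomial.aeval v f) = MvPolynomial.aeval (fun i => σ (v i)) f := fun v =>
    MvPolynomial.comp_aeval_apply (φ := (σ : L →ₐ[K] L)) v f
  have hswap : ∀ s t : K,
      algebraMap K L s * algebraMap K L t * (σ a * algebraMap K L s + σ b * algebraMap K L t) =
        algebraMap K L t * algebraMap K L s *
          (a * algebraMap K L t + b * algebraMap K L s) := by
    intro s t
    have h := congrArg σ (hab (algebraMap K L s) (algebraMap K L t))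
    rw [hconj] at h
    simp only [map_add, map_mul, AlgEquiv.commutes, hσσ] at h
    rw [← h, ← hab]
    simp only [add_comm]
  have hab' : σ a = b := by
    have h₁ := hswap 1 1
    have h₂ := hswap 1 (-1)
    simp only [map_one, map_neg] at h₁ h₂
    apply mul_left_cancel₀ h2L
    linear_combination h₁ - h₂
  have hba : σ b = a := by rw [← hab', hσσ]
  have hσz : ∀ i, σ (z i) = -z i := by
    intro i
    simp [hzdef, hab', hba, hσσ]
  have hdesc : ∀ i, ∃ w : K, z i = sqd * algebraMap K L w := by
    intro i
    obtain ⟨u, w, huw⟩ := hspan (z i)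
    have h := hσz i
    simp only [huw, map_add, map_mul, AlgEquiv.commutes, hσ] at h
    have hu : algebraMap K L u = 0 := by
      apply mul_left_cancel₀ h2L
      linear_combination h
    exact ⟨w, by rw [huw, hu]; ring⟩
  choose w hw using hdesc
  refine ⟨hab', hσz, w, ?_, hw, ?_⟩
  · rintro rfl
    exact hz (funext fun i => by simp [hw i])
  · have hfz : MvPolynomial.aeval z f = 0 := by
      have h := hab b (-a)
      have hz' : (fun i => b * x i + -a * σ (x i)) = z := by
        rw [hzdef]; funext i; ring
      rw [hz'] at h
      rw [h]; ring
    rw [funext hw, hf.aeval_mul_left] at hfz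
    have hfw := (mul_eq_zero.mp hfz).resolve_left (pow_ne_zero 3 hsqd0)
    have hcast : MvPolynomial.aeval (fun i => algebraMap K L (w i)) f =
        algebraMap K L (MvPolynomial.eval w f) := by
      rw [← MvPolynomial.aeval_eq_eval]
      exact MvPolynomial.aeval_algebraMap_apply L w f
    rw [hcast] at hfw
    exact (map_eq_zero (algebraMap K L)).mp hfw
end
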